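/- arXiv:math/0004099 — 2 statements merged into one kernel-verified Lean document; each statement's English description precedes it below -/
import Mathlib

section
/- Let b be an integer. Then: (i) (ξ−1)^{ℓ(r−1)/2} divides γ_b(ξ) in ℤ[ξ]; (ii) if moreover r does not divide b, then γ_b(ξ) = u·(ξ−1)^{ℓ(r−1)/2} for some unit u of the ring ℤ[ξ]. -/
/-- Cast an integer vector to a rational vector. -/
def intVecQ {l : ℕ} (x : Fin l → ℤ) : Fin l → ℚ := fun i => (x i : ℚ)

/-- Cast a vector of residues `k ∈ {0,…,r−1}^l` to a rational vector. -/
def finVecQ {l r : ℕ} (k : Fin l → Fin r) : Fin l → ℚ := fun i => ((k i : ℕ) : ℚ)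

open Matrix in
lemma gauss_mul {R : Type*} [CommRing R] [IsDomain R] {p : ℕ} [Fact p.Prime]
    (ψ : AddChar (ZMod p) R) (hψ : ψ.IsPrimitive) {l : ℕ} (A : Matrix (Fin l) (Fin l) (ZMod p))
    (hA : Aᵀ = A) (hdet : A.det ≠ 0) (c : Fin l → ZMod p) (t : ZMod p) (ht : 2 * t ≠ 0) :
    (∑ x : Fin l → ZMod p, ψ (c ⬝ᵥ x + t * (x ⬝ᵥ A *ᵥ x))) *
      (∑ x : Fin l → ZMod p, ψ (-(c ⬝ᵥ x + t * (x ⬝ᵥ A *ᵥ x)))) = (p : R) ^ l := by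
  classical
  have key : ∀ h : Fin l → ZMod p,
      ∑ y : Fin l → ZMod p, ψ ((2 * t) * ((A *ᵥ h) ⬝ᵥ y)) = if h = 0 then (p : R) ^ l else 0 := by
    intro h
    let χ : AddChar (Fin l → ZMod p) R :=
      { toFun := fun y => ψ ((2 * t) * ((A *ᵥ h) ⬝ᵥ y))
        map_zero_eq_one' := by simp
        map_add_eq_mul' := fun x y => by
          rw [dotProduct_add, mul_add, AddChar.map_add_eq_mul] }
    have hχ : ∀ y, χ y = ψ ((2 * t) * ((A *ᵥ h) ⬝ᵥ y)) := fun y => rfl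
    simp_rw [← hχ]
    rw [AddChar.sum_eq_ite]
    by_cases hh : h = 0
    · have : χ = 0 := by
        ext y
        rw [hχ, hh]; simp
      simp [this, hh, ZMod.card]
    · have hne : χ ≠ 0 := by
        intro h0
        have hv : A *ᵥ h ≠ 0 := fun h1 => hh (eq_zero_of_mulVec_eq_zero hdet h1)
        obtain ⟨i, hi⟩ := Function.ne_iff.1 hv
        apply hψ (mul_ne_zero ht hi)
        ext a
        have := hχ (Pi.single i a)
        rw [h0] at this
        rw [AddChar.mulShift_apply]
        simpa [dotProduct_single, mul_assoc] using this.symm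
      simp [hne, hh]
  rw [Finset.sum_mul_sum, Finset.sum_comm]
  have step : ∀ y : Fin l → ZMod p,
      ∑ x : Fin l → ZMod p, ψ (c ⬝ᵥ x + t * (x ⬝ᵥ A *ᵥ x)) * ψ (-(c ⬝ᵥ y + t * (y ⬝ᵥ A *ᵥ y)))
      = ∑ h : Fin l → ZMod p, ψ (c ⬝ᵥ h + t * (h ⬝ᵥ A *ᵥ h)) * ψ ((2 * t) * ((A *ᵥ h) ⬝ᵥ y)) := by
    intro y
    rw [← Equiv.sum_comp (Equiv.addRight y)]
    refine Finset.sum_congr rfl fun h _ => ?_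
    rw [← AddChar.map_add_eq_mul, ← AddChar.map_add_eq_mul]
    congr 1
    have e1 : h ⬝ᵥ A *ᵥ y = (A *ᵥ h) ⬝ᵥ y := by
      rw [dotProduct_mulVec, ← mulVec_transpose, hA]
    have e2 : y ⬝ᵥ A *ᵥ h = (A *ᵥ h) ⬝ᵥ y := dotProduct_comm _ _
    simp only [Equiv.coe_addRight, mulVec_add, add_dotProduct, dotProduct_add, e1, e2]
    ring
  simp_rw [step]
  rw [Finset.sum_comm]
  simp_rw [← Finset.mul_sum, key]
  simp

lemma assoc_of_mul {R : Type*} [CommRing R] [IsDomain R] (π S : R) (hπ : Prime π)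
    (σ : R ≃+* R) (hσ : Associated π (σ π)) (m : ℕ)
    (h : Associated (π ^ (2 * m)) (S * σ S)) : Associated (π ^ m) S := by
  obtain ⟨i, hi, hS⟩ := (dvd_prime_pow hπ (2 * m)).1 ((dvd_mul_right _ _).trans h.symm.dvd)
  have h2 : Associated (σ S) (π ^ i) := by
    have h3 : Associated (σ S) (σ (π ^ i)) := hS.map σ
    rw [map_pow] at h3
    exact h3.trans (hσ.symm.pow_pow)
  have h4 := h.trans (hS.mul_mul h2)
  rw [← pow_add] at h4
  have a1 := (pow_dvd_pow_iff hπ.ne_zero hπ.not_isUnit).1 h4.dvd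
  have a2 := (pow_dvd_pow_iff hπ.ne_zero hπ.not_isUnit).1 h4.symm.dvd
  have : i = m := by omega
  rw [← this]; exact hS.symm

open NumberField IsCyclotomicExtension in
lemma cyc_model' (r : ℕ) (hr : r.Prime) (K : Type) [Field K] [NumberField K]
    [IsCyclotomicExtension {r} ℚ K] (ξ : ℂ) (hξ : IsPrimitiveRoot ξ r) :
    ∃ (R : Type) (_ : CommRing R) (_ : IsDomain R) (ζ : R) (σ : R ≃+* R) (f : R →+* ℂ),
      IsPrimitiveRoot ζ r ∧ Prime (ζ - 1) ∧ Associated ((ζ - 1) ^ (r - 1)) (r : R) ∧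
      σ ζ * ζ = 1 ∧ Associated (ζ - 1) (σ (ζ - 1)) ∧ f ζ = ξ ∧
      ∀ x, f x ∈ Subring.closure ({ξ} : Set ℂ) := by
  have : Fact r.Prime := ⟨hr⟩
  have : NeZero r := ⟨hr.ne_zero⟩
  have hζ : IsPrimitiveRoot (zeta r ℚ K) r := zeta_spec r ℚ K
  have hirr := Polynomial.cyclotomic.irreducible_rat hr.pos
  let τ : Gal(K/ℚ) := fromZetaAut hζ.inv hirr
  have hτ : τ (zeta r ℚ K) = (zeta r ℚ K)⁻¹ := fromZetaAut_spec hζ.inv hirr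
  let σ : 𝓞 K ≃+* 𝓞 K := RingOfIntegers.mapRingEquiv τ.toRingEquiv
  let φ : K →ₐ[ℚ] ℂ := (hζ.embeddingsEquivPrimitiveRoots ℂ hirr).symm
    ⟨ξ, (mem_primitiveRoots hr.pos).2 hξ⟩
  have hφ : φ (zeta r ℚ K) = ξ := by
    have := hζ.embeddingsEquivPrimitiveRoots_apply_coe ℂ hirr φ
    rw [← this]; simp [φ]
  let f : 𝓞 K →+* ℂ := φ.toRingHom.comp (algebraMap (𝓞 K) K)
  have hf : f hζ.toInteger = ξ := hφ
  have hσ : σ hζ.toInteger * hζ.toInteger = 1 := by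
    apply RingOfIntegers.ext
    change τ (zeta r ℚ K) * zeta r ℚ K = 1
    rw [hτ]; exact inv_mul_cancel₀ (hζ.ne_zero hr.ne_zero)
  refine ⟨𝓞 K, inferInstance, inferInstance, hζ.toInteger, σ, f, hζ.toInteger_isPrimitiveRoot,
    hζ.zeta_sub_one_prime', ?_, hσ, ?_, hf, ?_⟩
  · exact IsCyclotomicExtension.Rat.associated_zeta_sub_one_pow_prime r hζ
  · rw [map_sub, map_one]
    have hu : IsUnit (σ hζ.toInteger) := IsUnit.of_mul_eq_one _ hσ
    have : σ hζ.toInteger - 1 = (hζ.toInteger - 1) * (-σ hζ.toInteger) := by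
      linear_combination hσ
    rw [this]
    exact (associated_mul_unit_right _ _ hu.neg)
  · intro x
    have hx : x ∈ Algebra.adjoin ℤ {hζ.toInteger} := by
      have := hζ.integralPowerBasis.adjoin_gen_eq_top
      rw [hζ.integralPowerBasis_gen] at this
      rw [this]; trivial
    induction hx using Algebra.adjoin_induction with
    | mem x hx => 
      rw [Set.mem_singleton_iff.1 hx, hf]
      exact Subring.subset_closure rfl
    | algebraMap n => simp
    | add x y _ _ h1 h2 => rw [map_add]; exact add_mem h1 h2
    | mul x y _ _ h1 h2 => rw [map_mul]; exact mul_mem h1 h2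

lemma cyc_model (r : ℕ) (hr : r.Prime) (ξ : ℂ) (hξ : IsPrimitiveRoot ξ r) :
    ∃ (R : Type) (_ : CommRing R) (_ : IsDomain R) (ζ : R) (σ : R ≃+* R) (f : R →+* ℂ),
      IsPrimitiveRoot ζ r ∧ Prime (ζ - 1) ∧ Associated ((ζ - 1) ^ (r - 1)) (r : R) ∧
      σ ζ * ζ = 1 ∧ Associated (ζ - 1) (σ (ζ - 1)) ∧ f ζ = ξ ∧
      ∀ x, f x ∈ Subring.closure ({ξ} : Set ℂ) := by
  have : NeZero r := ⟨hr.ne_zero⟩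
  have : NeZero ((r : ℕ) : ℚ) := ⟨Nat.cast_ne_zero.2 hr.ne_zero⟩
  have : @IsCyclotomicExtension {r} ℚ (CyclotomicField r ℚ) _ _ DivisionRing.toRatAlgebra := by
    have h := CyclotomicField.isCyclotomicExtension r ℚ
    have e : CyclotomicField.algebra r ℚ = DivisionRing.toRatAlgebra := Subsingleton.elim _ _
    rw [← e]
    exact h
  exact cyc_model' r hr (CyclotomicField r ℚ) ξ hξ

open Matrix in
lemma exponent_formula (l r : ℕ)
    (B : (Fin l → ℚ) →ₗ[ℚ] (Fin l → ℚ) →ₗ[ℚ] ℚ)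
    (hBsymm : ∀ x y, B x y = B y x) (ρ : Fin l → ℚ)
    (P : Matrix (Fin l) (Fin l) ℤ)
    (hP : ∀ i j, (P i j : ℚ) = B (Pi.single i 1) (Pi.single j 1))
    (c : Fin l → ℤ) (hc : ∀ i, (c i : ℚ) = B ρ (Pi.single i 1))
    (b g : ℤ) (k : Fin l → Fin r)
    (hg : (g : ℚ) = (b : ℚ) * (B (ρ + finVecQ k) (ρ + finVecQ k) - B ρ ρ) / 2)
    (z : Fin l → ℤ) (hz : ∀ i, z i = ((k i : ℕ) : ℤ)) :
    2 * g = b * (2 * (c ⬝ᵥ z) + z ⬝ᵥ P *ᵥ z) := by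
  have hk : finVecQ k = ∑ i, (z i : ℚ) • (Pi.single i 1 : Fin l → ℚ) := by
    ext j
    simp [finVecQ, Finset.sum_apply, Pi.single_apply, hz]
  have h1 : B ρ (finVecQ k) = ((c ⬝ᵥ z : ℤ) : ℚ) := by
    rw [hk]
    simp [dotProduct, hc, mul_comm]
  have h2 : B (finVecQ k) (finVecQ k) = ((z ⬝ᵥ P *ᵥ z : ℤ) : ℚ) := by
    rw [hk]
    simp only [map_sum, map_smul, LinearMap.sum_apply, LinearMap.smul_apply, smul_eq_mul,
      dotProduct, mulVec, Int.cast_sum, Int.cast_mul, hP, Finset.mul_sum]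
    rw [Finset.sum_comm]
    refine Finset.sum_congr rfl fun i _ => Finset.sum_congr rfl fun j _ => ?_
    ring
  have h3 : (2 * g : ℚ) = b * (2 * ((c ⬝ᵥ z : ℤ) : ℚ) + ((z ⬝ᵥ P *ᵥ z : ℤ) : ℚ)) := by
    rw [hg, ← h1, ← h2]
    simp only [map_add, LinearMap.add_apply]
    rw [hBsymm (finVecQ k) ρ]
    ring
  exact_mod_cast h3


/-- for `r` an odd prime coprime with `det P`, the Gauss sum
`γ_b(ξ) = ∑_{k ∈ {0,…,r−1}^ℓ} ξ^{b(B(ρ+k,ρ+k) − B(ρ,ρ))/2}` is divisible by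
`(ξ−1)^{ℓ(r−1)/2}` in `ℤ[ξ]`, and if moreover `r ∤ b` it equals a unit of `ℤ[ξ]`
times `(ξ−1)^{ℓ(r−1)/2}`. -/
theorem stmt0 (l r : ℕ) (hl : 0 < l) (hrp : Nat.Prime r) (hodd : Odd r)
    (B : (Fin l → ℚ) →ₗ[ℚ] (Fin l → ℚ) →ₗ[ℚ] ℚ)
    (hBsymm : ∀ x y, B x y = B y x)
    (hBint : ∀ x y : Fin l → ℤ, ∃ n : ℤ, (n : ℚ) = B (intVecQ x) (intVecQ y))
    (hBeven : ∀ y : Fin l → ℤ, ∃ n : ℤ, ((2 * n : ℤ) : ℚ) = B (intVecQ y) (intVecQ y))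
    (ρ : Fin l → ℚ)
    (hρ : ∀ y : Fin l → ℤ, ∃ n : ℤ, (n : ℚ) = B ρ (intVecQ y))
    (dP : ℤ)
    (hdP : (dP : ℚ) = (Matrix.of fun i j : Fin l => B (Pi.single i 1) (Pi.single j 1)).det)
    (hcop : IsCoprime (r : ℤ) dP)
    (ξ : ℂ) (hξ : IsPrimitiveRoot ξ r)
    (b : ℤ)
    (g : (Fin l → Fin r) → ℤ)
    (hg : ∀ k : Fin l → Fin r, ((g k : ℤ) : ℚ) =
      (b : ℚ) * (B (ρ + finVecQ k) (ρ + finVecQ k) - B ρ ρ) / 2) :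
    (∃ cc ∈ Subring.closure ({ξ} : Set ℂ),
        ∑ k : Fin l → Fin r, ξ ^ (g k) = (ξ - 1) ^ (l * (r - 1) / 2) * cc) ∧
      (¬ (r : ℤ) ∣ b →
        ∃ u ∈ Subring.closure ({ξ} : Set ℂ),
          (∃ v ∈ Subring.closure ({ξ} : Set ℂ), u * v = 1) ∧
            ∑ k : Fin l → Fin r, ξ ^ (g k) = u * (ξ - 1) ^ (l * (r - 1) / 2)) := by
  have : Fact r.Prime := ⟨hrp⟩
  have : NeZero r := ⟨hrp.ne_zero⟩
  have hsingle : ∀ i : Fin l, intVecQ (Pi.single i 1) = (Pi.single i 1 : Fin l → ℚ) := by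
    intro i
    ext j
    by_cases h : j = i <;> simp [intVecQ, h]
  choose P' hP' using fun i j : Fin l => hBint (Pi.single i 1) (Pi.single j 1)
  simp only [hsingle] at hP'
  let P : Matrix (Fin l) (Fin l) ℤ := Matrix.of P'
  have hP : ∀ i j, (P i j : ℚ) = B (Pi.single i 1) (Pi.single j 1) := hP'
  choose c hc using fun i : Fin l => hρ (Pi.single i 1)
  simp only [hsingle] at hc
  let A : Matrix (Fin l) (Fin l) (ZMod r) := P.map (Int.castRingHom (ZMod r))
  have hA : A.transpose = A := by
    ext i j
    have : P j i = P i j := by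
      have h : (P j i : ℚ) = P i j := by rw [hP, hP, hBsymm]
      exact_mod_cast h
    simp [A, this]
  have hPdet : P.det = dP := by
    have h : (P.det : ℚ) = dP := by
      rw [hdP]
      change (Int.castRingHom ℚ) P.det = _
      rw [RingHom.map_det]
      congr 1
      ext i j
      simp [hP]
    exact_mod_cast h
  have hAdet : A.det ≠ 0 := by
    have h : A.det = ((P.det : ℤ) : ZMod r) := by
      change _ = (Int.castRingHom (ZMod r)) P.det
      rw [RingHom.map_det]
      rfl
    rw [h, hPdet, Ne, ZMod.intCast_zmod_eq_zero_iff_dvd]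
    intro hd
    have hu := hcop.isUnit_of_dvd' dvd_rfl hd
    exact (Nat.prime_iff_prime_int.1 hrp).not_isUnit hu
  have h2 : (2 : ZMod r) ≠ 0 := by
    intro h
    have h' : ((2 : ℕ) : ZMod r) = 0 := by exact_mod_cast h
    rw [ZMod.natCast_eq_zero_iff] at h'
    have := (Nat.prime_dvd_prime_iff_eq hrp Nat.prime_two).1 h'
    subst this
    exact absurd hodd (by decide)
  let cb : Fin l → ZMod r := fun i => (b : ZMod r) * (c i : ZMod r)
  let t : ZMod r := (b : ZMod r) * 2⁻¹
  let F : (Fin l → ZMod r) → ZMod r := fun x => cb ⬝ᵥ x + t * (x ⬝ᵥ A.mulVec x)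
  have hF : ∀ k : Fin l → Fin r, ((g k : ℤ) : ZMod r) = F (fun i => ((k i : ℕ) : ZMod r)) := by
    intro k
    have h := exponent_formula l r B hBsymm ρ P hP c hc b (g k) k (hg k)
      (fun i => ((k i : ℕ) : ℤ)) (fun i => rfl)
    have h' := congrArg (Int.cast : ℤ → ZMod r) h
    apply mul_left_cancel₀ h2
    have h'' : (2 : ZMod r) * ((g k : ℤ) : ZMod r) = ((2 * g k : ℤ) : ZMod r) := by push_cast; rfl
    rw [h'', h']
    have e2 : 2 * t = b := by
      simp only [t]; field_simp
    have e1 : cb ⬝ᵥ (fun i => ((k i : ℕ) : ZMod r))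
        = (b : ZMod r) * ((c ⬝ᵥ (fun i => ((k i : ℕ) : ℤ)) : ℤ) : ZMod r) := by
      simp [dotProduct, cb, Finset.mul_sum, mul_assoc]
    have e3 : (fun i => ((k i : ℕ) : ZMod r)) ⬝ᵥ A.mulVec (fun i => ((k i : ℕ) : ZMod r))
        = (((fun i => ((k i : ℕ) : ℤ)) ⬝ᵥ P.mulVec (fun i => ((k i : ℕ) : ℤ)) : ℤ) : ZMod r) := by
      simp [dotProduct, Matrix.mulVec, A]
    simp only [F]
    rw [e1, e3, Int.cast_mul, Int.cast_add, Int.cast_mul, Int.cast_ofNat]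
    linear_combination (-(((fun i => ((k i : ℕ) : ℤ)) ⬝ᵥ P.mulVec (fun i => ((k i : ℕ) : ℤ)) : ℤ) :
      ZMod r)) * e2
  obtain ⟨R, _, _, ζ, σ, f, hζ, hπ, hass, hσζ, hσπ, hfζ, hfR⟩ := cyc_model r hrp ξ hξ
  let ψ : AddChar (ZMod r) R := AddChar.zmodChar r hζ.pow_eq_one
  have hψ : ψ.IsPrimitive := AddChar.zmodChar_primitive_of_primitive_root r hζ
  have hfψ : ∀ n : ℤ, f (ψ (n : ZMod r)) = ξ ^ n := by
    intro n
    have hξ0 : ξ ≠ 0 := hξ.ne_zero hrp.ne_zero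
    rw [AddChar.zmodChar_apply, map_pow, hfζ, ← zpow_natCast, ZMod.val_intCast]
    conv_rhs => rw [← Int.mul_ediv_add_emod n r, zpow_add₀ hξ0, zpow_mul, zpow_natCast,
      hξ.pow_eq_one, one_zpow, one_mul]
  have hσψ : ∀ a, σ (ψ a) = ψ (-a) := by
    intro a
    have h1 : σ (ψ a) * ψ a = 1 := by
      rw [AddChar.zmodChar_apply, map_pow, ← mul_pow, hσζ, one_pow]
    have h3 : ψ (-a) * ψ a = 1 := by
      rw [← AddChar.map_add_eq_mul]; simp
    have h4 : ψ a ≠ 0 := by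
      intro h0; rw [h0, mul_zero] at h1; exact zero_ne_one h1
    exact mul_right_cancel₀ h4 (h1.trans h3.symm)
  have hbij : Function.Bijective
      (fun (k : Fin l → Fin r) (i : Fin l) => ((k i : ℕ) : ZMod r)) := by
    rw [Fintype.bijective_iff_injective_and_card]
    refine ⟨fun k k' h => ?_, by simp [ZMod.card]⟩
    ext i
    have := congrArg ZMod.val (congrFun h i)
    simpa [ZMod.val_natCast, Nat.mod_eq_of_lt (k i).2, Nat.mod_eq_of_lt (k' i).2] using this
  let S : R := ∑ x : Fin l → ZMod r, ψ (F x)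
  have hS : ∑ k : Fin l → Fin r, ξ ^ (g k) = f S := by
    simp only [S, map_sum]
    refine Fintype.sum_bijective _ hbij _ _ fun k => ?_
    rw [← hF, hfψ]
  obtain ⟨m, hm⟩ : ∃ m, r - 1 = 2 * m := by
    obtain ⟨m, hm⟩ := hodd
    exact ⟨m, by omega⟩
  have hexp : l * (r - 1) / 2 = l * m := by
    rw [hm, show l * (2 * m) = 2 * (l * m) by ring]; simp
  have hπξ : f (ζ - 1) = ξ - 1 := by rw [map_sub, hfζ, map_one]
  have hassl : Associated ((ζ - 1) ^ (2 * (l * m))) ((r : R) ^ l) := by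
    have := hass.pow_pow (n := l)
    rwa [hm, ← pow_mul, show 2 * m * l = 2 * (l * m) by ring] at this
  rw [hS, hexp]
  have main : ¬ (r : ℤ) ∣ b → Associated ((ζ - 1) ^ (l * m)) S := by
    intro hb
    have hb0 : (b : ZMod r) ≠ 0 := by
      rwa [Ne, ZMod.intCast_zmod_eq_zero_iff_dvd]
    have ht : 2 * t ≠ 0 := by
      have e2 : 2 * t = b := by
        simp only [t]; field_simp
      rwa [e2]
    refine assoc_of_mul _ S hπ σ hσπ _ ?_
    have hσS : σ S = ∑ x : Fin l → ZMod r, ψ (-(F x)) := by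
      simp only [S, map_sum, hσψ]
    rw [hσS, gauss_mul ψ hψ A hA hAdet cb t ht]
    exact hassl
  constructor
  · have hdvd : (ζ - 1) ^ (l * m) ∣ S := by
      by_cases hb : (r : ℤ) ∣ b
      · have hb0 : (b : ZMod r) = 0 := by
          rwa [ZMod.intCast_zmod_eq_zero_iff_dvd]
        have hS' : S = (r : R) ^ l := by
          simp [S, F, cb, t, hb0, dotProduct, ZMod.card]
        rw [hS']
        exact (pow_dvd_pow _ (by omega)).trans hassl.dvd
      · exact (main hb).dvd
    obtain ⟨q, hq⟩ := hdvd
    exact ⟨f q, hfR q, by rw [hq, map_mul, map_pow, hπξ]⟩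
  · intro hb
    obtain ⟨u, hu⟩ := main hb
    refine ⟨f u, hfR _, ⟨f (u⁻¹ : Rˣ), hfR _, ?_⟩, ?_⟩
    · rw [← map_mul, Units.mul_inv, map_one]
    · rw [← hu, map_mul, map_pow, hπξ, mul_comm]
end

section
/- Let r be an odd prime, ξ ∈ ℂ a primitive r-th root of unity, and P an ℓ×ℓ symmetric matrix with integer entries, all of whose diagonal entries are even, such that gcd(det P, r) = 1. Then ∑_{k ∈ {0,…,r−1}^ℓ} ξ^{(kᵀ P k)/2} = u·(ξ−1)^{ℓ(r−1)/2} for some unit u of ℤ[ξ]. -/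
theorem aux_sum {A R ι : Type*} [AddCommMonoid A] [CommMonoid R] (ψ : AddChar A R)
    (s : Finset ι) (f : ι → A) : ψ (∑ i ∈ s, f i) = ∏ i ∈ s, ψ (f i) := by
  classical
  induction s using Finset.induction_on with
  | empty => simp
  | insert a s ha ih => rw [Finset.sum_insert ha, Finset.prod_insert ha, AddChar.map_add_eq_mul, ih]

open Finset in
theorem aux_T {R : Type*} [CommRing R] [IsDomain R] (n : ℕ)
    (hp : Nat.Prime (2 * n + 1)) (ζ : R) (hζ : IsPrimitiveRoot ζ (2 * n + 1)) :
    ∃ T : R, T ^ 2 = (-1) ^ n * ((2 * n + 1 : ℕ) : R) ∧ Associated ((ζ - 1) ^ n) T := by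
  refine ⟨∏ j ∈ range n, ζ ^ (n * (j + 1)) * (1 - ζ ^ (j + 1)), ?_, ?_⟩
  · have h := hζ.prod_one_sub_pow_eq_order (n := 2 * n)
    have h1 : ((2 * n + 1 : ℕ) : R) = ∏ k ∈ range (2 * n), (1 - ζ ^ (k + 1)) := by
      rw [h]; push_cast; ring
    rw [h1, two_mul n, prod_range_add, ← prod_range_reflect (fun x => 1 - ζ ^ (n + x + 1)) n,
      ← prod_mul_distrib, ← prod_pow]
    have : ((-1 : R)) ^ n = ∏ j ∈ range n, (-1 : R) := by simp
    rw [this, ← prod_mul_distrib]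
    refine prod_congr rfl fun j hj => ?_
    have hj' := mem_range.1 hj
    have e1 : n + (n - 1 - j) + 1 = 2 * n - j := by omega
    rw [e1]
    have e2 : ζ ^ (n * (j + 1)) * ζ ^ (n * (j + 1)) = ζ ^ (2 * n - j) := by
      rw [← pow_add]
      have : n * (j + 1) + n * (j + 1) = (2 * n - j) + (2 * n + 1) * j := by
        zify [show j ≤ 2 * n by omega]; ring
      rw [this, pow_add, pow_mul, hζ.pow_eq_one]; simp
    have e3 : ζ ^ (2 * n - j) * ζ ^ (j + 1) = 1 := by
      rw [← pow_add, show 2 * n - j + (j + 1) = 2 * n + 1 by omega, hζ.pow_eq_one]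
    generalize ζ ^ (n * (j + 1)) = a at *
    generalize ζ ^ (2 * n - j) = b at *
    generalize ζ ^ (j + 1) = c at *
    linear_combination (1 - c) ^ 2 * e2 + (c - 1) * e3
  · have : (ζ - 1) ^ n = ∏ j ∈ range n, (ζ - 1) := by simp
    rw [this]
    refine Associated.prod _ _ _ fun j hj => ?_
    have hj' := mem_range.1 hj
    have hu : IsUnit (ζ ^ (n * (j + 1))) := (hζ.isUnit (by omega)).pow _
    have hc : (j + 1).Coprime (2 * n + 1) :=
      by
      rw [Nat.coprime_comm, hp.coprime_iff_not_dvd]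
      exact Nat.not_dvd_of_pos_of_lt (by omega) (by omega)
    have h := hζ.associated_sub_one_pow_sub_one_of_coprime hc
    have h2 : Associated (ζ ^ (j + 1) - 1) (1 - ζ ^ (j + 1)) := by
      rw [← neg_sub]; exact (Associated.refl _).neg_left
    exact (h.trans h2).trans ((associated_isUnit_mul_right_iff hu).2 (Associated.refl _))

open Finset in
theorem aux_G {R : Type*} [CommRing R] [IsDomain R] [CharZero R] (n : ℕ)
    [Fact (Nat.Prime (2 * n + 1))] (_hn : 0 < n) (ψ : AddChar (ZMod (2 * n + 1)) R)
    (hψ : ψ.IsPrimitive) (a : ZMod (2 * n + 1)) (ha : a ≠ 0) :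
    (∑ x, ψ (a * (x * x))) ^ 2 = (-1) ^ n * ((2 * n + 1 : ℕ) : R) := by
  classical
  have hF : ringChar (ZMod (2 * n + 1)) ≠ 2 := by
    rw [ZMod.ringChar_zmod_n]; omega
  set φ : AddChar (ZMod (2 * n + 1)) R := ψ.mulShift a with hφ
  have hφ1 : φ ≠ 1 := hψ ha
  have hφp : φ.IsPrimitive := AddChar.IsPrimitive.of_ne_one hφ1
  let χ : MulChar (ZMod (2 * n + 1)) R := (quadraticChar _).ringHomComp (Int.castRingHom R)
  have hχq : χ.IsQuadratic := (quadraticChar_isQuadratic _).comp _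
  have hχ1 : χ ≠ 1 :=
    (MulChar.ringHomComp_ne_one_iff (RingHom.injective_int _)).2 (quadraticChar_ne_one hF)
  have key : ∑ x, ψ (a * (x * x)) = gaussSum χ φ := by
    have h0 : ∑ y, φ y = 0 := AddChar.sum_eq_zero_of_ne_one hφ1
    have h1 : ∑ x, ψ (a * (x * x)) = ∑ y, ∑ x with x ^ 2 = y, φ y := by
      rw [← sum_fiberwise (s := univ) (g := fun x : ZMod (2 * n + 1) => x ^ 2)]
      refine sum_congr rfl fun y _ => sum_congr rfl fun x hx => ?_
      rw [← (mem_filter.1 hx).2, hφ, AddChar.mulShift_apply, sq]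
    rw [h1, ← add_zero (gaussSum χ φ), ← h0, gaussSum, ← sum_add_distrib]
    refine sum_congr rfl fun y _ => ?_
    have h2 := quadraticChar_card_sqrts hF y
    have h3 : (#{x : ZMod (2 * n + 1) | x ^ 2 = y} : ℤ) = quadraticChar _ y + 1 := by
      rw [← h2]; congr 2; ext; simp
    have h4 : (#{x : ZMod (2 * n + 1) | x ^ 2 = y} : R) = χ y + 1 := by
      have := congrArg (Int.cast : ℤ → R) h3
      simpa [χ] using this
    rw [sum_const, nsmul_eq_mul, h4]; ring
  rw [key, gaussSum_sq hχ1 hχq hφp, ZMod.card]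
  congr 1
  have := quadraticChar_neg_one hF
  rw [ZMod.card, ZMod.χ₄_eq_neg_one_pow (by omega), show (2 * n + 1) / 2 = n by omega] at this
  simp [χ, this]

open Finset in
theorem aux_main {R : Type*} [CommRing R] [IsDomain R] [CharZero R] (n l : ℕ)
    [Fact (Nat.Prime (2 * n + 1))] (hn : 0 < n) (ζ : R) (hζ : IsPrimitiveRoot ζ (2 * n + 1))
    (M : Matrix (Fin l) (Fin l) (ZMod (2 * n + 1))) (hM : M.IsSymm) (hd : M.det ≠ 0) :
    Associated ((ζ - 1) ^ (l * n))
      (∑ x : Fin l → ZMod (2 * n + 1), AddChar.zmodChar (2 * n + 1) hζ.pow_eq_one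
        (∑ i, ∑ j, x i * M i j * x j)) := by
  classical
  have hp : Nat.Prime (2 * n + 1) := Fact.out
  set ψ := AddChar.zmodChar (2 * n + 1) hζ.pow_eq_one with hψd
  have hψ : ψ.IsPrimitive := AddChar.zmodChar_primitive_of_primitive_root _ hζ
  have h2 : (2 : ZMod (2 * n + 1)) ≠ 0 :=
    Ring.two_ne_zero (by rw [ZMod.ringChar_zmod_n]; omega)
  let _ : Invertible (2 : ZMod (2 * n + 1)) := invertibleOfNonzero h2
  let B : LinearMap.BilinForm (ZMod (2 * n + 1)) (Fin l → ZMod (2 * n + 1)) :=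
    Matrix.toLinearMap₂' (ZMod (2 * n + 1)) M
  have hB : ∀ x y, B x y = ∑ i, ∑ j, x i * M i j * y j := by
    intro x y
    simp only [B, Matrix.toLinearMap₂'_apply, smul_eq_mul]
    exact sum_congr rfl fun i _ => sum_congr rfl fun j _ => by ring
  have hsep : B.SeparatingLeft := LinearMap.separatingLeft_toLinearMap₂'_iff_det_ne_zero.2 hd
  have hsym : ∀ x y, B x y = B y x := by
    intro x y
    rw [hB, hB, sum_comm]
    refine sum_congr rfl fun i _ => sum_congr rfl fun j _ => ?_
    rw [hM.apply i j]; ring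
  let Q : QuadraticForm (ZMod (2 * n + 1)) (Fin l → ZMod (2 * n + 1)) :=
    LinearMap.BilinMap.toQuadraticMap B
  have hQ : (QuadraticMap.associated (R := ZMod (2 * n + 1)) Q).SeparatingLeft := by
    have : QuadraticMap.associated (R := ZMod (2 * n + 1)) Q = B :=
      QuadraticMap.associated_left_inverse _ hsym
    rw [this]; exact hsep
  obtain ⟨w, ⟨e⟩⟩ := Q.equivalent_weightedSumSquares_units_of_nondegenerate' hQ
  obtain ⟨T, hT, hTa⟩ := aux_T n hp ζ hζ
  have hsum : (∑ x : Fin l → ZMod (2 * n + 1), ψ (∑ i, ∑ j, x i * M i j * x j))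
      = ∏ i, ∑ x, ψ ((w i : ZMod (2 * n + 1)) * (x * x)) := by
    rw [Fintype.prod_sum]
    refine Fintype.sum_equiv e.toLinearEquiv.toEquiv _ _ fun x => ?_
    have h1 : ∑ i, ∑ j, x i * M i j * x j = Q x := by rw [← hB]; rfl
    rw [h1, ← e.map_app x, QuadraticMap.weightedSumSquares_apply, aux_sum]
    rfl
  rw [hsum]
  have hl : l * n = n * Module.finrank (ZMod (2 * n + 1)) (Fin l → ZMod (2 * n + 1)) := by
    simp [mul_comm]
  have : (ζ - 1) ^ (l * n) = ∏ i : Fin (Module.finrank (ZMod (2 * n + 1))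
      (Fin l → ZMod (2 * n + 1))), (ζ - 1) ^ n := by
    rw [prod_const, card_univ, Fintype.card_fin, hl, pow_mul]
  rw [this]
  refine Associated.prod _ _ _ fun i _ => hTa.trans ?_
  have := aux_G n hn ψ hψ (w i) (w i).ne_zero
  rw [← hT, sq_eq_sq_iff_eq_or_eq_neg] at this
  rcases this with h | h
  · rw [h]
  · rw [h]; exact (Associated.refl _).neg_right

open Finset in
theorem aux_even {l : ℕ} (P : Matrix (Fin l) (Fin l) ℤ) (hPsymm : P.IsSymm)
    (hPdiag : ∀ i, 2 ∣ P i i) (k : Fin l → ℤ) :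
    (2 : ℤ) ∣ ∑ i, ∑ j, k i * P i j * k j := by
  have h := (ZMod.intCast_zmod_eq_zero_iff_dvd (∑ i, ∑ j, k i * P i j * k j) 2)
  refine h.1 ?_
  rw [← Fintype.sum_prod_type' (fun i j => k i * P i j * k j), Int.cast_sum]
  refine sum_involution (fun a _ => a.swap) ?_ ?_ (by simp) (by simp)
  · rintro ⟨i, j⟩ _
    simp only [Prod.swap]
    rw [hPsymm.apply i j, ← Int.cast_add]
    refine (ZMod.intCast_zmod_eq_zero_iff_dvd _ 2).2 ⟨k i * P i j * k j, ?_⟩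
    push_cast; ring
  · rintro ⟨i, j⟩ _ hne heq
    simp only [Prod.swap, Prod.mk.injEq] at heq
    apply hne
    rw [heq.1]
    refine (ZMod.intCast_zmod_eq_zero_iff_dvd _ 2).2 ?_
    exact Dvd.dvd.mul_right (Dvd.dvd.mul_left (hPdiag i) _) _

/-- for an odd prime `r`, a primitive `r`-th root of unity `ξ`, and an even
symmetric integer matrix `P` with `gcd(det P, r) = 1`, the Gauss sum
`∑_{k ∈ {0,…,r−1}^ℓ} ξ^{(kᵀPk)/2}` is a unit of `ℤ[ξ]` times `(ξ−1)^{ℓ(r−1)/2}`. -/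
theorem stmt4 (l r : ℕ) (hl : 0 < l) (hrp : Nat.Prime r) (hodd : Odd r)
    (ξ : ℂ) (hξ : IsPrimitiveRoot ξ r)
    (P : Matrix (Fin l) (Fin l) ℤ) (hPsymm : P.IsSymm) (hPdiag : ∀ i, 2 ∣ P i i)
    (hcop : IsCoprime P.det (r : ℤ)) :
    ∃ u ∈ Subring.closure ({ξ} : Set ℂ),
      (∃ v ∈ Subring.closure ({ξ} : Set ℂ), u * v = 1) ∧
        ∑ k : Fin l → Fin r,
            ξ ^ ((∑ i : Fin l, ∑ j : Fin l, ((k i : ℕ) : ℤ) * P i j * ((k j : ℕ) : ℤ)) / 2)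
          = u * (ξ - 1) ^ (l * (r - 1) / 2) := by
  classical
  obtain ⟨n, rfl⟩ := hodd
  have : Fact (Nat.Prime (2 * n + 1)) := ⟨hrp⟩
  have hn : 0 < n := by
    rcases Nat.eq_zero_or_pos n with h | h
    · subst h; exact absurd hrp (by norm_num)
    · exact h
  have h2 : (2 : ZMod (2 * n + 1)) ≠ 0 :=
    Ring.two_ne_zero (by rw [ZMod.ringChar_zmod_n]; omega)
  let S := Subring.closure ({ξ} : Set ℂ)
  let ζ : S := ⟨ξ, Subring.subset_closure rfl⟩
  have hζ : IsPrimitiveRoot ζ (2 * n + 1) :=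
    IsPrimitiveRoot.of_map_of_injective (f := S.subtype) (by simpa [ζ] using hξ)
      Subtype.val_injective
  let ψ := AddChar.zmodChar (2 * n + 1) hζ.pow_eq_one
  have hξ0 : ξ ≠ 0 := hξ.ne_zero (by omega)
  have hψ : ∀ m : ℤ, ((ψ (m : ZMod (2 * n + 1)) : S) : ℂ) = ξ ^ m := by
    intro m
    have h1 : ((ψ (m : ZMod (2 * n + 1)) : S) : ℂ) = ξ ^ ((m : ZMod (2 * n + 1)).val) := by
      simp only [ψ, AddChar.zmodChar_apply]; rfl
    rw [h1, ← zpow_natCast, ZMod.val_intCast]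
    conv_rhs => rw [← Int.emod_add_mul_ediv m ((2 * n + 1 : ℕ) : ℤ)]
    rw [zpow_add₀ hξ0, zpow_mul, zpow_natCast, hξ.pow_eq_one, one_zpow, mul_one]
  let M : Matrix (Fin l) (Fin l) (ZMod (2 * n + 1)) :=
    (2 : ZMod (2 * n + 1))⁻¹ • P.map (Int.castRingHom _)
  have hM : M.IsSymm := by
    ext i j
    simp [M, hPsymm.apply i j]
  have hd : M.det ≠ 0 := by
    rw [Matrix.det_smul]
    refine mul_ne_zero (pow_ne_zero _ (inv_ne_zero h2)) ?_
    have : (P.map (Int.castRingHom (ZMod (2 * n + 1)))).det = ((P.det : ℤ) : ZMod (2 * n + 1)) :=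
      ((Int.castRingHom (ZMod (2 * n + 1))).map_det P).symm
    rw [this]
    intro h
    have := hcop.map (Int.castRingHom (ZMod (2 * n + 1)))
    simp only [eq_intCast, h, Int.cast_natCast, ZMod.natCast_self] at this
    exact not_isCoprime_zero_zero this
  obtain ⟨u, hu⟩ := aux_main n l hn ζ hζ M hM hd
  refine ⟨((u : S) : ℂ), (u : S).2, ⟨((u⁻¹ : Sˣ) : S), ((u⁻¹ : Sˣ) : S).2, ?_⟩, ?_⟩
  · exact_mod_cast congrArg (Subtype.val) u.mul_inv
  · have hu' := congrArg (Subtype.val : S → ℂ) hu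
    have hexp : l * (2 * n + 1 - 1) / 2 = l * n := by
      rw [Nat.add_sub_cancel, show l * (2 * n) = 2 * (l * n) by ring]; omega
    rw [hexp, mul_comm ((u : S) : ℂ)]
    have e : ((((ζ - 1) ^ (l * n) * (u : S) : S)) : ℂ) = (ξ - 1) ^ (l * n) * ((u : S) : ℂ) := by
      simp [ζ]
    rw [← e, hu']
    have e2 : ∀ f : (Fin l → ZMod (2 * n + 1)) → S,
        ((∑ x, f x : S) : ℂ) = ∑ x, (f x : ℂ) := fun f => by simp
    rw [e2]
    refine Fintype.sum_equiv (Equiv.refl _) _ _ fun k => ?_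
    rw [← hψ]
    change _ = ((ψ _ : S) : ℂ)
    congr 2
    have heven : (2 : ℤ) ∣ ∑ i : Fin l, ∑ j : Fin l, ((k i : ℕ) : ℤ) * P i j * ((k j : ℕ) : ℤ) :=
      aux_even P hPsymm hPdiag fun i => ((k i : ℕ) : ℤ)
    obtain ⟨m, hm⟩ := heven
    have hk : ∀ i, (((k i : ℕ) : ℤ) : ZMod (2 * n + 1)) = (k i : ZMod (2 * n + 1)) := by
      intro i
      rw [Int.cast_natCast]
      exact ZMod.natCast_zmod_val (n := 2 * n + 1) (k i)
    have hm' := congrArg (Int.cast : ℤ → ZMod (2 * n + 1)) hm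
    rw [hm, Int.mul_ediv_cancel_left _ two_ne_zero]
    push_cast [-Int.cast_natCast, hk] at hm'
    apply mul_left_cancel₀ h2
    rw [← hm', Finset.mul_sum]
    refine Finset.sum_congr rfl fun i _ => ?_
    rw [Finset.mul_sum]
    refine Finset.sum_congr rfl fun j _ => ?_
    have hc : ∀ a b c : ZMod (2 * n + 1), a * b * c = 2 * (a * (2⁻¹ * b) * c) := by
      intro a b c
      field_simp
    exact hc _ _ _
end
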